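/- Let n ≥ 3, c ∈ ℝ, K := (n(n−2))^{(n−2)/4}, and define φ(y) := c − K|y|^{2−n} for y ∈ ℝ^n ∖ {0}. Then ∫_{S^{n−1}} ( ((n−2)/2) φ ∂_ν φ + (∂_ν φ)² − (1/2) |∇φ|² ) dℋ^{n−1} = (1/2) n^{(n−2)/4} (n−2)^{(n+6)/4} ω_{n−1} c, where the integral is over the unit sphere S^{n−1} = ∂B(0,1) ⊂ ℝ^n, ∂_ν φ(y) := ⟨∇φ(y), y⟩ is the outward normal derivative on S^{n−1}, and ω_{n−1} := ℋ^{n−1}(S^{n−1}). -/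

import Mathlib

open MeasureTheory
open scoped RealInnerProductSpace

/-- Boundary computation on the unit sphere for the blow-up profile
`φ(y) = c − K|y|^{2−n}` with `K = (n(n−2))^{(n−2)/4}` (`n ≥ 3`):
`∫_{S^{n−1}} (((n−2)/2) φ ∂_ν φ + (∂_ν φ)² − (1/2)|∇φ|²) dℋ^{n−1}
  = (1/2) n^{(n−2)/4} (n−2)^{(n+6)/4} ω_{n−1} c`,
where `∂_ν φ(y) = ⟨∇φ(y), y⟩` and `ω_{n−1} = ℋ^{n−1}(S^{n−1})`. -/
theorem sphere_boundary_integral_profile (n : ℕ) (hn : 3 ≤ n) (c K : ℝ)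
    (hK : K = ((n : ℝ) * ((n : ℝ) - 2)) ^ (((n : ℝ) - 2) / 4))
    (φ : EuclideanSpace ℝ (Fin n) → ℝ)
    (hφ : ∀ y : EuclideanSpace ℝ (Fin n), y ≠ 0 →
      φ y = c - K * ‖y‖ ^ ((2 : ℝ) - (n : ℝ)))
    (ω : ℝ)
    (hω : ω = (μH[(n : ℝ) - 1] (Metric.sphere (0 : EuclideanSpace ℝ (Fin n)) 1)).toReal) :
    (∫ y in Metric.sphere (0 : EuclideanSpace ℝ (Fin n)) 1,
        (((n : ℝ) - 2) / 2 * φ y * ⟪gradient φ y, y⟫ + ⟪gradient φ y, y⟫ ^ 2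
          - 1 / 2 * ‖gradient φ y‖ ^ 2) ∂(μH[(n : ℝ) - 1]))
      = 1 / 2 * (n : ℝ) ^ (((n : ℝ) - 2) / 4) * ((n : ℝ) - 2) ^ (((n : ℝ) + 6) / 4)
          * ω * c := by
  have hn' : (3 : ℝ) ≤ (n : ℝ) := by exact_mod_cast hn
  have hgrad : ∀ y : EuclideanSpace ℝ (Fin n), ‖y‖ = 1 →
      gradient φ y = (K * ((n : ℝ) - 2)) • y := by
    intro y hy
    have hy0 : y ≠ 0 := by
      rintro rfl
      simp at hy
    apply HasGradientAt.gradient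
    rw [hasGradientAt_iff_hasFDerivAt]
    have h1 : HasFDerivAt (fun x : EuclideanSpace ℝ (Fin n) => ‖x‖ ^ 2)
        (2 • innerSL ℝ y) y := (hasStrictFDerivAt_norm_sq y).hasFDerivAt
    have h2 := ((h1.rpow_const (p := ((2 : ℝ) - n) / 2)
      (Or.inl (by simp [hy]))).const_mul K).const_sub c
    have h3 := h2.congr_of_eventuallyEq (f₁ := φ) (by
      filter_upwards [isOpen_ne.mem_nhds hy0] with x hx
      rw [hφ x hx, ← Real.rpow_natCast, ← Real.rpow_mul (norm_nonneg x)]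
      congr 3
      push_cast
      ring)
    refine h3.congr_fderiv ?_
    ext x
    simp [hy]
    ring
  have hconst : ∀ y ∈ Metric.sphere (0 : EuclideanSpace ℝ (Fin n)) 1,
      (((n : ℝ) - 2) / 2 * φ y * ⟪gradient φ y, y⟫ + ⟪gradient φ y, y⟫ ^ 2
          - 1 / 2 * ‖gradient φ y‖ ^ 2) = 1 / 2 * (K * ((n : ℝ) - 2) ^ 2) * c := by
    intro y hy
    have hy1 : ‖y‖ = 1 := by simpa using hy
    have hy0 : y ≠ 0 := by
      rintro rfl
      simp at hy1
    rw [hgrad y hy1, hφ y hy0, real_inner_smul_left, real_inner_self_eq_norm_sq, norm_smul, hy1,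
      Real.one_rpow, mul_one ‖_‖, Real.norm_eq_abs, sq_abs]
    ring
  rw [setIntegral_congr_fun Metric.isClosed_sphere.measurableSet hconst, setIntegral_const,
    smul_eq_mul, measureReal_def, ← hω]
  have hKe : K * ((n : ℝ) - 2) ^ 2
      = (n : ℝ) ^ (((n : ℝ) - 2) / 4) * ((n : ℝ) - 2) ^ (((n : ℝ) + 6) / 4) := by
    rw [hK, Real.mul_rpow (by linarith) (by linarith), mul_assoc, ← Real.rpow_natCast,
      ← Real.rpow_add (by linarith)]
    congr 2
    push_cast
    ring
  rw [hKe]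
  ring
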